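/- For an integer s ≥ 1 and λ > 0, define κ^V_{s,λ} as the supremum, over all finite simple graphs G = (V,E) with |E| ≤ s, all pendant edges i ∈ E with endpoints u, v such that u has degree 1, and all vertex pinnings τ = (B₊, B₋) with B₊ ∪ B₋ ⊆ V∖{u,v} such that both events {M satisfies τ and i ∈ M} and {M satisfies τ and i ∉ M} have positive probability under μ_{G,λ}, of the Wasserstein distance, with respect to the metric d(M,M') = |(V(M) △ V(M'))∖{u}|, between the conditional distribution of M given (τ and i ∈ M) and the conditional distribution of M given (τ and i ∉ M). Then for every s ≥ 1, κ^V_{s+1,λ} ≤ max{κ^V_{s,λ}, 1}. -/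

import Mathlib

open scoped Classical

namespace SensMatching

variable {V : Type*} [Fintype V] [DecidableEq V]

/-- `M` is a matching of `G`: a finset of edges of `G`, no two of which share an endpoint. -/
def IsMatchingSet (G : SimpleGraph V) (M : Finset (Sym2 V)) : Prop :=
  (∀ e ∈ M, e ∈ G.edgeSet) ∧
    ∀ e ∈ M, ∀ f ∈ M, e ≠ f → ∀ v : V, v ∈ e → v ∉ f

/-- The finset of all matchings of `G`. -/
noncomputable def matchings (G : SimpleGraph V) : Finset (Finset (Sym2 V)) :=
  Finset.univ.filter fun M => IsMatchingSet G M

/-- `ν(G)`: the maximum size of a matching of `G`. -/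
noncomputable def nu (G : SimpleGraph V) : ℕ :=
  (matchings G).sup Finset.card

/-- `m_k(G)`: the number of matchings of size `k` in `G`. -/
noncomputable def numMatchings (G : SimpleGraph V) (k : ℕ) : ℕ :=
  ((matchings G).filter fun M => M.card = k).card

/-- The degree of a vertex `v` in `G`. -/
noncomputable def degr (G : SimpleGraph V) (v : V) : ℕ :=
  (Finset.univ.filter fun w => G.Adj v w).card

/-- The finset of edges of `G`. -/
noncomputable def edges (G : SimpleGraph V) : Finset (Sym2 V) :=
  Finset.univ.filter fun e => e ∈ G.edgeSet

/-- The partition function `Z_G(λ) = Σ_{M matching} λ^{|M|}`. -/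
noncomputable def partitionFn (G : SimpleGraph V) (lam : ℝ) : ℝ :=
  ∑ M ∈ matchings G, lam ^ M.card

/-- The probability, under the Gibbs distribution `μ_{G,λ}`, of the event `p`. -/
noncomputable def gibbsProb (G : SimpleGraph V) (lam : ℝ) (p : Finset (Sym2 V) → Prop) : ℝ :=
  (∑ M ∈ (matchings G).filter p, lam ^ M.card) / partitionFn G lam

/-- The law of `f M`, where `M` follows the Gibbs distribution `μ_{G,λ}` conditioned
on the event `p`. -/
noncomputable def condDistMap (G : SimpleGraph V) (lam : ℝ) (p : Finset (Sym2 V) → Prop)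
    (f : Finset (Sym2 V) → Finset (Sym2 V)) (N : Finset (Sym2 V)) : ℝ :=
  (∑ M ∈ ((matchings G).filter p).filter fun M => f M = N, lam ^ M.card) /
    ∑ M ∈ (matchings G).filter p, lam ^ M.card

/-- The Gibbs distribution `μ_{G,λ}` conditioned on the event `p`. -/
noncomputable def condDist (G : SimpleGraph V) (lam : ℝ) (p : Finset (Sym2 V) → Prop) :
    Finset (Sym2 V) → ℝ :=
  condDistMap G lam p id

/-- The Gibbs distribution `μ_{G,λ}` over matchings of `G`. -/
noncomputable def gibbsDist (G : SimpleGraph V) (lam : ℝ) : Finset (Sym2 V) → ℝ :=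
  condDist G lam fun _ => True

/-- `V(M)`: the set of vertices covered by the edge set `M`. -/
noncomputable def coveredVerts (M : Finset (Sym2 V)) : Finset V :=
  Finset.univ.filter fun v => ∃ e ∈ M, v ∈ e

/-- `N(i)`: the set of edges of `G` sharing an endpoint with `i`, excluding `i` itself. -/
def edgeNbhd (G : SimpleGraph V) (i : Sym2 V) : Set (Sym2 V) :=
  {e | e ∈ G.edgeSet ∧ e ≠ i ∧ ∃ v : V, v ∈ e ∧ v ∈ i}

/-- `π` is a coupling of the distributions `μ` and `μ'`. -/
def IsCoupling {α : Type*} [Fintype α] (π : α × α → ℝ) (μ μ' : α → ℝ) : Prop :=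
  (∀ q, 0 ≤ π q) ∧ (∀ a, ∑ b, π (a, b) = μ a) ∧ ∀ b, ∑ a, π (a, b) = μ' b

/-- The edge-Hamming distance `|M △ M'|`. -/
noncomputable def edist (M M' : Finset (Sym2 V)) : ℕ :=
  ((M \ M') ∪ (M' \ M)).card

/-- The vertex-Hamming distance `|V(M) △ V(M')|`. -/
noncomputable def vdist (M M' : Finset (Sym2 V)) : ℕ :=
  ((coveredVerts M \ coveredVerts M') ∪ (coveredVerts M' \ coveredVerts M)).card

/-- The vertex-Hamming distance ignoring the vertex `u`: `|(V(M) △ V(M')) \ {u}|`. -/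
noncomputable def vdistErase (u : V) (M M' : Finset (Sym2 V)) : ℕ :=
  (((coveredVerts M \ coveredVerts M') ∪ (coveredVerts M' \ coveredVerts M)).erase u).card

/-- `M` satisfies the vertex pinning `(Bp, Bm)`: every vertex of `Bp` is covered by `M`
and no vertex of `Bm` is covered by `M`. -/
def satisfiesPinning (M : Finset (Sym2 V)) (Bp Bm : Finset V) : Prop :=
  (∀ w ∈ Bp, w ∈ coveredVerts M) ∧ ∀ w ∈ Bm, w ∉ coveredVerts M

/-- The Wasserstein distance between `μ` and `μ'` with respect to the metric `d`:
the infimum over couplings of the expected distance. -/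
noncomputable def wass {α : Type*} [Fintype α] (d : α → α → ℝ) (μ μ' : α → ℝ) : ℝ :=
  sInf {c : ℝ | ∃ π : α × α → ℝ, IsCoupling π μ μ' ∧ c = ∑ q : α × α, π q * d q.1 q.2}

/-- `κ^V_{s,λ}`: the supremum, over graphs with at most `s` edges (realized on the
vertex set `Fin (2s)`), pendant edges `i = s(u,v)` with `deg u = 1`, and vertex pinnings
`(Bp, Bm)` avoiding `u, v` for which both pinned events have positive probability, of
the Wasserstein distance (w.r.t. the metric `|(V(M) △ V(M'))∖{u}|`) between the Gibbs
distribution conditioned on (the pinning and `i ∈ M`) and conditioned on (the pinning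
and `i ∉ M`). -/
noncomputable def kappaV (s : ℕ) (lam : ℝ) : ℝ :=
  sSup {c : ℝ | ∃ (G : SimpleGraph (Fin (2 * s))) (u v : Fin (2 * s))
      (Bp Bm : Finset (Fin (2 * s))),
    (edges G).card ≤ s ∧ s(u, v) ∈ G.edgeSet ∧ degr G u = 1 ∧
    Disjoint Bp Bm ∧ u ∉ Bp ∪ Bm ∧ v ∉ Bp ∪ Bm ∧
    (0 < ∑ M ∈ (matchings G).filter
        (fun M => satisfiesPinning M Bp Bm ∧ s(u, v) ∈ M), lam ^ M.card) ∧
    (0 < ∑ M ∈ (matchings G).filter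
        (fun M => satisfiesPinning M Bp Bm ∧ s(u, v) ∉ M), lam ^ M.card) ∧
    c = wass (fun M M' => (vdistErase u M M' : ℝ))
        (condDist G lam (fun M => satisfiesPinning M Bp Bm ∧ s(u, v) ∈ M))
        (condDist G lam (fun M => satisfiesPinning M Bp Bm ∧ s(u, v) ∉ M))}

/-- A division-free form of the statement that the probability distributions on `S` and `T`
with weights proportional to `w` and `w'` admit a coupling of expected distance at most `c`. -/
def Coupled {α β : Type*} (w : α → ℝ) (w' : β → ℝ) (S : Finset α) (T : Finset β)
    (d : α → β → ℝ) (c : ℝ) : Prop :=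
  ∃ π : α → β → ℝ, (∀ a ∈ S, ∀ b ∈ T, 0 ≤ π a b) ∧
    (∀ a ∈ S, ∑ b ∈ T, π a b = w a * ∑ b ∈ T, w' b) ∧
    (∀ b ∈ T, ∑ a ∈ S, π a b = w' b * ∑ a ∈ S, w a) ∧
    ∑ a ∈ S, ∑ b ∈ T, π a b * d a b ≤ c * (∑ a ∈ S, w a) * ∑ b ∈ T, w' b

namespace Coupled

variable {α β α' β' ι : Type*} {w : α → ℝ} {w' : β → ℝ} {S : Finset α} {T : Finset β}
  {d : α → β → ℝ} {c : ℝ}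

theorem symm (h : Coupled w w' S T d c) : Coupled w' w T S (fun b a => d a b) c := by
  obtain ⟨π, h0, h1, h2, h3⟩ := h
  refine ⟨fun b a => π a b, fun b hb a ha => h0 a ha b hb, h2, h1, ?_⟩
  rw [Finset.sum_comm]
  linarith [mul_right_comm c (∑ a ∈ S, w a) (∑ b ∈ T, w' b)]

theorem of_empty_left : Coupled w w' ∅ T d c :=
  ⟨fun _ _ => 0, by simp, by simp, by simp, by simp⟩

theorem of_empty_right : Coupled w w' S ∅ d c :=
  ⟨fun _ _ => 0, by simp, by simp, by simp, by simp⟩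

theorem refl (hw : ∀ a ∈ S, 0 ≤ w a) {d : α → α → ℝ} (hd : ∀ a ∈ S, d a a ≤ c) :
    Coupled w w S S d c := by
  have hZ : 0 ≤ ∑ a ∈ S, w a := Finset.sum_nonneg hw
  refine ⟨fun a b => if a = b then w a * ∑ a ∈ S, w a else 0, ?_, ?_, ?_, ?_⟩
  · intro a ha b _
    dsimp only
    split_ifs
    · exact mul_nonneg (hw a ha) hZ
    · exact le_rfl
  · intro a ha
    simp [ha]
  · intro b hb
    rw [Finset.sum_ite_eq_of_mem' S b _ hb]
  · calc ∑ a ∈ S, ∑ b ∈ S, (if a = b then w a * ∑ a ∈ S, w a else 0) * d a b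
        = ∑ a ∈ S, (w a * ∑ a ∈ S, w a) * d a a := by
          refine Finset.sum_congr rfl fun a ha => ?_
          simp [ite_mul, ha]
      _ ≤ ∑ a ∈ S, (w a * ∑ a ∈ S, w a) * c := by
          refine Finset.sum_le_sum fun a ha => ?_
          exact mul_le_mul_of_nonneg_left (hd a ha) (mul_nonneg (hw a ha) hZ)
      _ = c * (∑ a ∈ S, w a) * ∑ a ∈ S, w a := by
          rw [← Finset.sum_mul, ← Finset.sum_mul]
          ring

/-- Couplings with the blocks of a partition of `T` glue to a coupling with `T`. -/
theorem of_fiberwise [DecidableEq ι] (j : β → ι)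
    (h : ∀ i, Coupled w w' S (T.filter fun b => j b = i) d c) : Coupled w w' S T d c := by
  choose π h0 h1 h2 h3 using h
  have key : ∀ f : β → ℝ, ∑ b ∈ T, f b =
      ∑ i ∈ T.image j, ∑ b ∈ T.filter (fun b => j b = i), f b := fun f =>
    (Finset.sum_fiberwise_of_maps_to (fun b hb => Finset.mem_image_of_mem j hb) f).symm
  refine ⟨fun a b => π (j b) a b, ?_, ?_, ?_, ?_⟩
  · intro a ha b hb
    exact h0 _ a ha b (by simp [hb])
  · intro a ha
    rw [key, key, Finset.mul_sum]
    refine Finset.sum_congr rfl fun i _ => ?_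
    rw [← h1 i a ha]
    refine Finset.sum_congr rfl fun b hb => ?_
    simp only [(Finset.mem_filter.1 hb).2]
  · intro b hb
    exact h2 (j b) b (by simp [hb])
  · rw [Finset.sum_comm, key, key, Finset.mul_sum]
    refine Finset.sum_le_sum fun i _ => ?_
    refine le_trans (le_of_eq ?_) (h3 i)
    rw [Finset.sum_comm]
    refine Finset.sum_congr rfl fun a _ => Finset.sum_congr rfl fun b hb => ?_
    simp only [(Finset.mem_filter.1 hb).2]

/-- Couplings transport along bijections that scale the weights and do not increase
distances. -/
theorem transport {w₀ : α' → ℝ} {w₀' : β' → ℝ} {S₀ : Finset α'} {T₀ : Finset β'}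
    {d₀ : α' → β' → ℝ} (h : Coupled w₀ w₀' S₀ T₀ d₀ c) {f : α → α'} {g : β → β'}
    (hf : Set.BijOn f S S₀) (hg : Set.BijOn g T T₀) {k l : ℝ} (hk : 0 ≤ k) (hl : 0 ≤ l)
    (hw : ∀ a ∈ S, w a = k * w₀ (f a)) (hw' : ∀ b ∈ T, w' b = l * w₀' (g b))
    (hd : ∀ a ∈ S, ∀ b ∈ T, d a b ≤ d₀ (f a) (g b)) : Coupled w w' S T d c := by
  obtain ⟨π, h0, h1, h2, h3⟩ := h
  have sumf : ∀ F : α' → ℝ, ∑ a ∈ S, F (f a) = ∑ a ∈ S₀, F a := fun F =>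
    Finset.sum_nbij f (fun a ha => hf.mapsTo ha) hf.injOn hf.surjOn fun _ _ => rfl
  have sumg : ∀ F : β' → ℝ, ∑ b ∈ T, F (g b) = ∑ b ∈ T₀, F b := fun F =>
    Finset.sum_nbij g (fun b hb => hg.mapsTo hb) hg.injOn hg.surjOn fun _ _ => rfl
  have hS : ∑ a ∈ S, w a = k * ∑ a ∈ S₀, w₀ a := by
    rw [Finset.sum_congr rfl hw, ← Finset.mul_sum, sumf]
  have hT : ∑ b ∈ T, w' b = l * ∑ b ∈ T₀, w₀' b := by
    rw [Finset.sum_congr rfl hw', ← Finset.mul_sum, sumg]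
  refine ⟨fun a b => k * l * π (f a) (g b), ?_, ?_, ?_, ?_⟩
  · intro a ha b hb
    exact mul_nonneg (mul_nonneg hk hl) (h0 _ (hf.mapsTo ha) _ (hg.mapsTo hb))
  · intro a ha
    rw [← Finset.mul_sum, sumg (fun b => π (f a) b), h1 _ (hf.mapsTo ha), hT, hw a ha]
    ring
  · intro b hb
    rw [← Finset.mul_sum, sumf (fun a => π a (g b)), h2 _ (hg.mapsTo hb), hS, hw' b hb]
    ring
  · calc ∑ a ∈ S, ∑ b ∈ T, k * l * π (f a) (g b) * d a b
        ≤ ∑ a ∈ S, ∑ b ∈ T, k * l * (π (f a) (g b) * d₀ (f a) (g b)) := by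
          refine Finset.sum_le_sum fun a ha => Finset.sum_le_sum fun b hb => ?_
          rw [mul_assoc (k * l)]
          exact mul_le_mul_of_nonneg_left (mul_le_mul_of_nonneg_left (hd a ha b hb)
            (h0 _ (hf.mapsTo ha) _ (hg.mapsTo hb))) (mul_nonneg hk hl)
      _ = k * l * ∑ a ∈ S₀, ∑ b ∈ T₀, π a b * d₀ a b := by
          simp_rw [← Finset.mul_sum]
          rw [← sumf]
          congr 1
          exact Finset.sum_congr rfl fun a _ => sumg fun b => π (f a) b * d₀ (f a) b
      _ ≤ k * l * (c * (∑ a ∈ S₀, w₀ a) * ∑ b ∈ T₀, w₀' b) :=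
          mul_le_mul_of_nonneg_left h3 (mul_nonneg hk hl)
      _ = c * (∑ a ∈ S, w a) * ∑ b ∈ T, w' b := by
          rw [hS, hT]
          ring

theorem wass_le {α : Type*} [Fintype α] [DecidableEq α] {w : α → ℝ} {S T : Finset α}
    {d : α → α → ℝ} (h : Coupled w w S T d c) (hS : 0 < ∑ a ∈ S, w a) (hT : 0 < ∑ a ∈ T, w a)
    (hd : ∀ a b, 0 ≤ d a b) {μ μ' : α → ℝ}
    (hμ : ∀ a, μ a = (if a ∈ S then w a else 0) / ∑ a ∈ S, w a)
    (hμ' : ∀ a, μ' a = (if a ∈ T then w a else 0) / ∑ a ∈ T, w a) :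
    wass d μ μ' ≤ c := by
  obtain ⟨π, h0, h1, h2, h3⟩ := h
  set Z := ∑ a ∈ S, w a with hZ
  set Z' := ∑ a ∈ T, w a with hZ'
  have hle : ∑ q : α × α, (if q.1 ∈ S ∧ q.2 ∈ T then π q.1 q.2 / (Z * Z') else 0) * d q.1 q.2
      ≤ c := by
    have : ∑ q : α × α, (if q.1 ∈ S ∧ q.2 ∈ T then π q.1 q.2 / (Z * Z') else 0) * d q.1 q.2
        = (∑ a ∈ S, ∑ b ∈ T, π a b * d a b) / (Z * Z') := by
      rw [Fintype.sum_prod_type, Finset.sum_div,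
        ← Finset.sum_subset (Finset.subset_univ S) fun a _ ha => by simp [ha]]
      refine Finset.sum_congr rfl fun a ha => ?_
      rw [Finset.sum_div,
        ← Finset.sum_subset (Finset.subset_univ T) fun b _ hb => by simp [hb]]
      refine Finset.sum_congr rfl fun b hb => ?_
      rw [if_pos ⟨ha, hb⟩]
      ring
    rw [this, div_le_iff₀ (mul_pos hS hT)]
    linarith
  refine le_trans (csInf_le ⟨0, ?_⟩ ⟨_, ⟨?_, ?_, ?_⟩, rfl⟩) hle
  · rintro _ ⟨π, hπ, rfl⟩
    exact Finset.sum_nonneg fun q _ => mul_nonneg (hπ.1 q) (hd _ _)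
  · rintro ⟨a, b⟩
    dsimp only
    split_ifs with h
    · exact div_nonneg (h0 a h.1 b h.2) (mul_pos hS hT).le
    · exact le_rfl
  · intro a
    rw [hμ]
    by_cases ha : a ∈ S
    · simp only [ha, true_and, if_true]
      rw [Finset.sum_ite_mem, Finset.univ_inter, ← Finset.sum_div, h1 a ha]
      field_simp
    · simp [ha]
  · intro b
    rw [hμ']
    by_cases hb : b ∈ T
    · simp only [hb, and_true, if_true]
      rw [Finset.sum_ite_mem, Finset.univ_inter, ← Finset.sum_div, h2 b hb]
      field_simp
    · simp [hb]

theorem of_wass_lt {α : Type*} [Fintype α] [DecidableEq α] {w : α → ℝ} {S T : Finset α}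
    {d : α → α → ℝ} (hw : ∀ a, 0 ≤ w a) (hS : 0 < ∑ a ∈ S, w a) (hT : 0 < ∑ a ∈ T, w a)
    {μ μ' : α → ℝ}
    (hμ : ∀ a, μ a = (if a ∈ S then w a else 0) / ∑ a ∈ S, w a)
    (hμ' : ∀ a, μ' a = (if a ∈ T then w a else 0) / ∑ a ∈ T, w a)
    (h : wass d μ μ' < c) : Coupled w w S T d c := by
  have nonneg : ∀ (U : Finset α) (a : α), 0 ≤ (if a ∈ U then w a else 0) / ∑ a ∈ U, w a := by
    intro U a
    refine div_nonneg ?_ (Finset.sum_nonneg fun a _ => hw a)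
    split_ifs
    · exact hw a
    · exact le_rfl
  have total : ∀ U : Finset α, 0 < ∑ a ∈ U, w a →
      ∑ a, (if a ∈ U then w a else 0) / ∑ a ∈ U, w a = 1 := by
    intro U hU
    rw [← Finset.sum_div, Finset.sum_ite_mem, Finset.univ_inter, div_self hU.ne']
  obtain ⟨_, ⟨π, ⟨h0, h1, h2⟩, rfl⟩, hlt⟩ := exists_lt_of_csInf_lt (by
    refine ⟨_, fun q => μ q.1 * μ' q.2, ⟨?_, ?_, ?_⟩, rfl⟩
    · intro q
      simp only [hμ, hμ']
      exact mul_nonneg (nonneg S _) (nonneg T _)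
    · intro a
      dsimp only
      rw [← Finset.mul_sum, Finset.sum_congr rfl fun b _ => hμ' b, total T hT, mul_one]
    · intro b
      dsimp only
      rw [← Finset.sum_mul, Finset.sum_congr rfl fun a _ => hμ a, total S hS, one_mul]) h
  set Z := ∑ a ∈ S, w a with hZ
  set Z' := ∑ a ∈ T, w a with hZ'
  clear_value Z Z'
  have supS : ∀ a b, a ∉ S → π (a, b) = 0 := by
    intro a b ha
    refine (Finset.sum_eq_zero_iff_of_nonneg fun b _ => h0 (a, b)).1 ?_ b (Finset.mem_univ b)
    rw [h1 a, hμ]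
    simp [ha]
  have supT : ∀ a b, b ∉ T → π (a, b) = 0 := by
    intro a b hb
    refine (Finset.sum_eq_zero_iff_of_nonneg fun a _ => h0 (a, b)).1 ?_ a (Finset.mem_univ a)
    rw [h2 b, hμ']
    simp [hb]
  refine ⟨fun a b => π (a, b) * (Z * Z'), ?_, ?_, ?_, ?_⟩
  · intro a _ b _
    exact mul_nonneg (h0 _) (mul_pos hS hT).le
  · intro a ha
    rw [← hZ', ← Finset.sum_mul, Finset.sum_subset (Finset.subset_univ T) fun b _ hb => supT a b hb,
      h1 a, hμ, if_pos ha]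
    field_simp
  · intro b hb
    rw [← hZ, ← Finset.sum_mul, Finset.sum_subset (Finset.subset_univ S) fun a _ ha => supS a b ha,
      h2 b, hμ', if_pos hb]
    field_simp
  · have : ∑ a ∈ S, ∑ b ∈ T, π (a, b) * (Z * Z') * d a b
        = (∑ q : α × α, π q * d q.1 q.2) * (Z * Z') := by
      rw [Fintype.sum_prod_type, Finset.sum_mul,
        ← Finset.sum_subset (Finset.subset_univ S) fun a _ ha => by simp [supS a _ ha]]
      refine Finset.sum_congr rfl fun a _ => ?_
      rw [Finset.sum_mul,
        ← Finset.sum_subset (Finset.subset_univ T) fun b _ hb => by simp [supT a b hb]]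
      exact Finset.sum_congr rfl fun b _ => by ring
    rw [this, mul_assoc, ← hZ, ← hZ']
    exact mul_le_mul_of_nonneg_right hlt.le (mul_pos hS hT).le

end Coupled

omit [DecidableEq V] in
theorem mem_matchings {G : SimpleGraph V} {M : Finset (Sym2 V)} :
    M ∈ matchings G ↔ IsMatchingSet G M := by
  simp [matchings]

theorem mem_coveredVerts {M : Finset (Sym2 V)} {x : V} :
    x ∈ coveredVerts M ↔ ∃ e ∈ M, x ∈ e := by
  simp [coveredVerts]

omit [DecidableEq V] in
theorem mem_edges {G : SimpleGraph V} {e : Sym2 V} : e ∈ edges G ↔ e ∈ G.edgeSet := by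
  simp [edges]

omit [Fintype V] in
theorem IsMatchingSet.eq_of_mem {G : SimpleGraph V} {M : Finset (Sym2 V)}
    (hM : IsMatchingSet G M) {e f : Sym2 V} (he : e ∈ M) (hf : f ∈ M) {x : V} (hxe : x ∈ e)
    (hxf : x ∈ f) : e = f := by
  by_contra h
  exact hM.2 e he f hf h x hxe hxf

/-- The matchings of `G` that satisfy the pinning `(Bp, Bm)` and the event `q`. -/
noncomputable def pinned (G : SimpleGraph V) (Bp Bm : Finset V)
    (q : Finset (Sym2 V) → Prop) : Finset (Finset (Sym2 V)) :=
  (matchings G).filter fun M => satisfiesPinning M Bp Bm ∧ q M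

theorem mem_pinned {G : SimpleGraph V} {Bp Bm : Finset V} {q : Finset (Sym2 V) → Prop}
    {M : Finset (Sym2 V)} :
    M ∈ pinned G Bp Bm q ↔ IsMatchingSet G M ∧ satisfiesPinning M Bp Bm ∧ q M := by
  simp [pinned, mem_matchings]

/-- The graph obtained from `G` by deleting all edges at `v`. -/
def isolate (G : SimpleGraph V) (v : V) : SimpleGraph V where
  Adj a b := G.Adj a b ∧ a ≠ v ∧ b ≠ v
  symm := ⟨fun _ _ h => ⟨h.1.symm, h.2.2, h.2.1⟩⟩
  loopless := ⟨fun _ h => h.1.ne rfl⟩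

/-- The graph obtained from `G` by deleting all edges at `v` other than `s(v, w)`. -/
def makePendant (G : SimpleGraph V) (v w : V) : SimpleGraph V where
  Adj a b := G.Adj a b ∧ (a = v → b = w) ∧ (b = v → a = w)
  symm := ⟨fun _ _ h => ⟨h.1.symm, h.2.2, h.2.1⟩⟩
  loopless := ⟨fun _ h => h.1.ne rfl⟩

omit [Fintype V] [DecidableEq V] in
theorem mem_edgeSet_isolate {G : SimpleGraph V} {v : V} {e : Sym2 V} :
    e ∈ (isolate G v).edgeSet ↔ e ∈ G.edgeSet ∧ v ∉ e := by
  induction e with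
  | _ a b => simp [isolate, eq_comm]

omit [Fintype V] [DecidableEq V] in
theorem mem_edgeSet_makePendant {G : SimpleGraph V} {v w : V} {e : Sym2 V} :
    e ∈ (makePendant G v w).edgeSet ↔ e ∈ G.edgeSet ∧ (v ∈ e → e = s(v, w)) := by
  induction e with
  | _ a b =>
    simp only [SimpleGraph.mem_edgeSet, makePendant, Sym2.mem_iff, Sym2.eq_iff]
    constructor
    · rintro ⟨h, h1, h2⟩
      refine ⟨h, ?_⟩
      rintro (rfl | rfl)
      · exact Or.inl ⟨rfl, h1 rfl⟩
      · exact Or.inr ⟨h2 rfl, rfl⟩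
    · rintro ⟨h, h1⟩
      have := h.ne
      refine ⟨h, ?_, ?_⟩ <;> grind

theorem isMatchingSet_isolate {G : SimpleGraph V} {v : V} {M : Finset (Sym2 V)} :
    IsMatchingSet (isolate G v) M ↔ IsMatchingSet G M ∧ v ∉ coveredVerts M := by
  simp only [IsMatchingSet, mem_edgeSet_isolate, mem_coveredVerts]
  grind

omit [Fintype V] [DecidableEq V] in
theorem isMatchingSet_makePendant {G : SimpleGraph V} {v w : V} {M : Finset (Sym2 V)} :
    IsMatchingSet (makePendant G v w) M ↔
      IsMatchingSet G M ∧ ∀ e ∈ M, v ∈ e → e = s(v, w) := by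
  simp only [IsMatchingSet, mem_edgeSet_makePendant]
  grind

omit [DecidableEq V] in
theorem edges_isolate_ssubset {G : SimpleGraph V} {v w : V} (h : G.Adj v w) :
    edges (isolate G v) ⊂ edges G := by
  refine Finset.ssubset_iff_of_subset (fun e he => ?_) |>.2 ⟨s(v, w), mem_edges.2 h, ?_⟩
  · exact mem_edges.2 (mem_edgeSet_isolate.1 (mem_edges.1 he)).1
  · rw [mem_edges, mem_edgeSet_isolate]
    simp

omit [DecidableEq V] in
theorem edges_makePendant_subset (G : SimpleGraph V) (v w : V) :
    edges (makePendant G v w) ⊆ edges G := fun _ he =>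
  mem_edges.2 (mem_edgeSet_makePendant.1 (mem_edges.1 he)).1

theorem degr_makePendant {G : SimpleGraph V} {v w : V} (h : G.Adj v w) :
    degr (makePendant G v w) v = 1 := by
  rw [degr, Finset.card_eq_one]
  refine ⟨w, ?_⟩
  ext x
  have := h.ne
  simp only [Finset.mem_filter, Finset.mem_univ, true_and, makePendant, Finset.mem_singleton]
  grind

omit [DecidableEq V] in
theorem eq_of_degr_eq_one {G : SimpleGraph V} {u v w : V} (hd : degr G u = 1)
    (hv : G.Adj u v) (hw : G.Adj u w) : w = v := by
  obtain ⟨x, hx⟩ := Finset.card_eq_one.1 hd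
  have h1 : v ∈ Finset.univ.filter fun w => G.Adj u w := by simpa using hv
  have h2 : w ∈ Finset.univ.filter fun w => G.Adj u w := by simpa using hw
  rw [hx, Finset.mem_singleton] at h1 h2
  rw [h1, h2]

theorem coveredVerts_insert (M : Finset (Sym2 V)) (v w : V) :
    coveredVerts (insert s(v, w) M) = insert v (insert w (coveredVerts M)) := by
  ext x
  simp only [mem_coveredVerts, Finset.mem_insert, exists_eq_or_imp, Sym2.mem_iff, or_assoc]

theorem vdistErase_insert_le {M N : Finset (Sym2 V)} {v w : V} (hw : w ∈ coveredVerts N) :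
    vdistErase v (insert s(v, w) M) N ≤ vdistErase w M N := by
  refine Finset.card_le_card fun x => ?_
  simp only [coveredVerts_insert, Finset.mem_erase, Finset.mem_union, Finset.mem_sdiff,
    Finset.mem_insert]
  grind

theorem vdistErase_insert_self_le (M : Finset (Sym2 V)) (u v : V) :
    vdistErase u (insert s(u, v) M) M ≤ 1 := by
  refine Finset.card_le_one.2 fun x hx y hy => ?_
  simp only [coveredVerts_insert, Finset.mem_erase, Finset.mem_union, Finset.mem_sdiff,
    Finset.mem_insert] at hx hy
  grind

theorem vdistErase_comm (u : V) (M N : Finset (Sym2 V)) :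
    vdistErase u M N = vdistErase u N M := by
  rw [vdistErase, vdistErase, Finset.union_comm]

theorem notMem_coveredVerts_erase {G : SimpleGraph V} {M : Finset (Sym2 V)}
    (hM : IsMatchingSet G M) {e : Sym2 V} (he : e ∈ M) {x : V} (hx : x ∈ e) :
    x ∉ coveredVerts (M.erase e) := by
  rw [mem_coveredVerts]
  rintro ⟨f, hf, hxf⟩
  rw [Finset.mem_erase] at hf
  exact hf.1 (hM.eq_of_mem hf.2 he hxf hx)

/-- Erasing `s(v, w)` identifies the matchings containing it with the matchings of the graph
with `v` isolated that do not cover `w`. -/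
theorem bijOn_erase {G : SimpleGraph V} {v w : V} (h : G.Adj v w) {Bp Bm : Finset V}
    (hvp : v ∉ Bp) (hvm : v ∉ Bm) (hwm : w ∉ Bm) :
    Set.BijOn (fun M : Finset (Sym2 V) => M.erase s(v, w))
      (pinned G Bp Bm fun M => s(v, w) ∈ M : Finset (Finset (Sym2 V)))
      (pinned (isolate G v) (Bp.erase w) Bm fun M => w ∉ coveredVerts M : Finset (Finset (Sym2 V))) := by
  have cov : ∀ M : Finset (Sym2 V), s(v, w) ∈ M → ∀ x, x ≠ v → x ≠ w →
      (x ∈ coveredVerts (M.erase s(v, w)) ↔ x ∈ coveredVerts M) := by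
    intro M hM x hxv hxw
    conv_rhs => rw [← Finset.insert_erase hM, coveredVerts_insert]
    simp [hxv, hxw]
  refine ⟨?_, ?_, ?_⟩
  · intro M hM
    obtain ⟨hM, ⟨hp, hm⟩, hmem⟩ := mem_pinned.1 hM
    refine mem_pinned.2 ⟨isMatchingSet_isolate.2 ⟨⟨?_, ?_⟩, ?_⟩, ⟨?_, ?_⟩, ?_⟩
    · exact fun e he => hM.1 e (Finset.mem_of_mem_erase he)
    · exact fun e he f hf => hM.2 e (Finset.mem_of_mem_erase he) f (Finset.mem_of_mem_erase hf)
    · exact notMem_coveredVerts_erase hM hmem (Sym2.mem_mk_left v w)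
    · intro x hx
      rw [Finset.mem_erase] at hx
      exact (cov M hmem x (fun hxv => hvp (hxv ▸ hx.2)) hx.1).2 (hp x hx.2)
    · intro x hx
      rw [cov M hmem x (fun hxv => hvm (hxv ▸ hx)) (fun hxw => hwm (hxw ▸ hx))]
      exact hm x hx
    · exact notMem_coveredVerts_erase hM hmem (Sym2.mem_mk_right v w)
  · intro M hM N hN hMN
    rw [← Finset.insert_erase (mem_pinned.1 hM).2.2, ← Finset.insert_erase (mem_pinned.1 hN).2.2]
    exact congrArg _ hMN
  · intro N hN
    obtain ⟨hN, ⟨hp, hm⟩, hw⟩ := mem_pinned.1 hN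
    obtain ⟨hN, hv⟩ := isMatchingSet_isolate.1 hN
    have hnot : s(v, w) ∉ N := fun hmem =>
      hv (mem_coveredVerts.2 ⟨_, hmem, Sym2.mem_mk_left v w⟩)
    have hdisj : ∀ f ∈ N, ∀ x ∈ s(v, w), x ∉ f := by
      intro f hf x hx hxf
      rcases Sym2.mem_iff.1 hx with rfl | rfl
      · exact hv (mem_coveredVerts.2 ⟨f, hf, hxf⟩)
      · exact hw (mem_coveredVerts.2 ⟨f, hf, hxf⟩)
    refine ⟨insert s(v, w) N, mem_pinned.2 ⟨⟨?_, ?_⟩, ⟨?_, ?_⟩, Finset.mem_insert_self _ _⟩,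
      Finset.erase_insert hnot⟩
    · intro e he
      rcases Finset.mem_insert.1 he with rfl | he
      · exact h
      · exact hN.1 e he
    · intro e he f hf hef x hxe hxf
      rcases Finset.mem_insert.1 he with rfl | he <;> rcases Finset.mem_insert.1 hf with rfl | hf
      · exact hef rfl
      · exact hdisj f hf x hxe hxf
      · exact hdisj e he x hxf hxe
      · exact hN.2 e he f hf hef x hxe hxf
    · intro x hx
      rw [coveredVerts_insert]
      by_cases hxw : x = w
      · simp [hxw]
      · simp [hp x (Finset.mem_erase.2 ⟨hxw, hx⟩)]
    · intro x hx
      rw [coveredVerts_insert]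
      simp only [Finset.mem_insert, not_or]
      exact ⟨fun hxv => hvm (hxv ▸ hx), fun hxw => hwm (hxw ▸ hx), hm x hx⟩

omit [Fintype V] in
theorem pow_card_eq_mul_pow_card_erase (lam : ℝ) {M : Finset (Sym2 V)} {e : Sym2 V}
    (he : e ∈ M) : lam ^ M.card = lam * lam ^ (M.erase e).card := by
  rw [← pow_succ', Finset.card_erase_add_one he]

/-- For every pendant edge `s(u, v)` of a graph on `V` with at most `s` edges, the matchings
containing it and those avoiding it, both pinned, admit a coupling of cost at most `c`. -/
def PendantBound (V : Type*) [Fintype V] [DecidableEq V] (lam : ℝ) (s : ℕ) (c : ℝ) : Prop :=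
  ∀ (G : SimpleGraph V) (u v : V) (Bp Bm : Finset V), (edges G).card ≤ s → G.Adj u v →
    degr G u = 1 → Disjoint Bp Bm → u ∉ Bp ∪ Bm → v ∉ Bp ∪ Bm →
    Coupled (fun M => lam ^ M.card) (fun M => lam ^ M.card)
      (pinned G Bp Bm fun M => s(u, v) ∈ M) (pinned G Bp Bm fun M => s(u, v) ∉ M)
      (fun M N => (vdistErase u M N : ℝ)) c

theorem coupled_uncovered_covered {lam : ℝ} (hlam : 0 < lam) {s : ℕ} {c : ℝ}
    (hc : PendantBound V lam s c) (H : SimpleGraph V) (v : V) (Bp Bm : Finset V)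
    (hs : (edges H).card ≤ s) (hdisj : Disjoint Bp Bm) (hvp : v ∉ Bp) (hvm : v ∉ Bm) :
    Coupled (fun M => lam ^ M.card) (fun M => lam ^ M.card)
      (pinned H Bp Bm fun M => v ∉ coveredVerts M) (pinned H Bp Bm fun M => v ∈ coveredVerts M)
      (fun M N => (vdistErase v M N : ℝ)) c := by
  induction hn : (edges H).card using Nat.strong_induction_on generalizing H v Bp Bm with
  | _ n ih =>
  subst hn
  let j : Finset (Sym2 V) → V := fun M =>
    if h : ∃ w, s(v, w) ∈ M then h.choose else v
  have hj : ∀ M ∈ pinned H Bp Bm (fun M => v ∈ coveredVerts M), ∀ w,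
      j M = w ↔ s(v, w) ∈ M := by
    intro M hM w
    obtain ⟨hM, -, hv⟩ := mem_pinned.1 hM
    obtain ⟨e, he, hve⟩ := mem_coveredVerts.1 hv
    obtain ⟨x, rfl⟩ := Sym2.mem_iff_exists.1 hve
    have hex : ∃ w, s(v, w) ∈ M := ⟨x, he⟩
    have hjM : s(v, j M) ∈ M := by
      simp only [j, dif_pos hex]
      exact hex.choose_spec
    constructor
    · rintro rfl
      exact hjM
    · intro hw
      exact Sym2.congr_right.1 (hM.eq_of_mem hjM hw (Sym2.mem_mk_left _ _) (Sym2.mem_mk_left _ _))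
  refine Coupled.of_fiberwise j fun w => ?_
  have hT : (pinned H Bp Bm fun M => v ∈ coveredVerts M).filter (fun M => j M = w) =
      pinned H Bp Bm fun M => s(v, w) ∈ M := by
    ext M
    rw [Finset.mem_filter]
    constructor
    · rintro ⟨hM, hw⟩
      have hw := (hj M hM w).1 hw
      obtain ⟨h1, h2, -⟩ := mem_pinned.1 hM
      exact mem_pinned.2 ⟨h1, h2, hw⟩
    · intro hM
      obtain ⟨h1, h2, hw⟩ := mem_pinned.1 hM
      have hM' : M ∈ pinned H Bp Bm fun M => v ∈ coveredVerts M :=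
        mem_pinned.2 ⟨h1, h2, mem_coveredVerts.2 ⟨_, hw, Sym2.mem_mk_left v w⟩⟩
      exact ⟨hM', (hj M hM' w).2 hw⟩
  rw [hT]
  rcases (pinned H Bp Bm fun M => s(v, w) ∈ M).eq_empty_or_nonempty with he | ⟨M₀, hM₀⟩
  · rw [he]
    exact Coupled.of_empty_right
  obtain ⟨hM₀, ⟨-, hm₀⟩, hvw₀⟩ := mem_pinned.1 hM₀
  have hadj : H.Adj v w := hM₀.1 _ hvw₀
  have hwm : w ∉ Bm := fun hw => hm₀ w hw (mem_coveredVerts.2 ⟨_, hvw₀, Sym2.mem_mk_right v w⟩)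
  by_cases hwp : w ∈ Bp
  · have hlt := Finset.card_lt_card (edges_isolate_ssubset hadj)
    have key := ih _ hlt (isolate H v) w (Bp.erase w) Bm (hlt.le.trans hs)
      (hdisj.mono_left (Finset.erase_subset _ _)) (Finset.notMem_erase _ _) hwm rfl
    have hS : (pinned H Bp Bm fun M => v ∉ coveredVerts M) =
        pinned (isolate H v) (Bp.erase w) Bm fun M => w ∈ coveredVerts M := by
      ext M
      simp only [mem_pinned, isMatchingSet_isolate, satisfiesPinning, Finset.mem_erase]
      grind
    rw [hS]
    refine key.symm.transport (Set.bijOn_id _) (bijOn_erase hadj hvp hvm hwm) zero_le_one hlam.le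
      (fun M _ => (one_mul _).symm) (fun N hN => pow_card_eq_mul_pow_card_erase _
        (mem_pinned.1 hN).2.2) fun M hM N hN => ?_
    rw [vdistErase_comm]
    have hle := vdistErase_insert_le (v := v) (M := N.erase s(v, w)) (mem_pinned.1 hM).2.2
    rw [Finset.insert_erase (mem_pinned.1 hN).2.2] at hle
    exact_mod_cast hle
  · have key := hc (makePendant H v w) v w Bp Bm
      ((Finset.card_le_card (edges_makePendant_subset H v w)).trans hs)
      ⟨hadj, fun _ => rfl, fun h => (hadj.ne h.symm).elim⟩ (degr_makePendant hadj) hdisj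
      (by simp [hvp, hvm]) (by simp [hwp, hwm])
    have hS : (pinned H Bp Bm fun M => v ∉ coveredVerts M) =
        pinned (makePendant H v w) Bp Bm fun M => s(v, w) ∉ M := by
      ext M
      simp only [mem_pinned, isMatchingSet_makePendant, mem_coveredVerts]
      grind [Sym2.mem_mk_left]
    have hT : (pinned H Bp Bm fun M => s(v, w) ∈ M) =
        pinned (makePendant H v w) Bp Bm fun M => s(v, w) ∈ M := by
      ext M
      simp only [mem_pinned, isMatchingSet_makePendant]
      constructor
      · rintro ⟨h1, h2, h3⟩
        exact ⟨⟨h1, fun e he hv => h1.eq_of_mem he h3 hv (Sym2.mem_mk_left v w)⟩, h2, h3⟩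
      · rintro ⟨⟨h1, -⟩, h2, h3⟩
        exact ⟨h1, h2, h3⟩
    rw [hS, hT]
    simpa only [vdistErase_comm] using key.symm

theorem PendantBound.succ {lam : ℝ} (hlam : 0 < lam) {s : ℕ} {c : ℝ}
    (hc : PendantBound V lam s c) (hc1 : 1 ≤ c) : PendantBound V lam (s + 1) c := by
  intro G u v Bp Bm hs hadj hdeg hdisj hu hv
  simp only [Finset.mem_union, not_or] at hu hv
  have hsub := Finset.card_lt_card (edges_isolate_ssubset hadj)
  have hT : (pinned G Bp Bm fun M => s(u, v) ∉ M) =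
      pinned (isolate G u) Bp Bm fun _ => True := by
    ext M
    simp only [mem_pinned, isMatchingSet_isolate]
    constructor
    · rintro ⟨h1, h2, h3⟩
      refine ⟨⟨h1, fun hcov => ?_⟩, h2, trivial⟩
      obtain ⟨e, he, hue⟩ := mem_coveredVerts.1 hcov
      obtain ⟨x, rfl⟩ := Sym2.mem_iff_exists.1 hue
      exact h3 (eq_of_degr_eq_one hdeg hadj (h1.1 _ he) ▸ he)
    · rintro ⟨⟨h1, h2⟩, h3, -⟩
      exact ⟨h1, h3, fun h => h2 (mem_coveredVerts.2 ⟨_, h, Sym2.mem_mk_left u v⟩)⟩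
  have hbij := bijOn_erase hadj hu.1 hu.2 hv.2
  rw [Finset.erase_eq_of_notMem hv.1] at hbij
  have hw : ∀ M ∈ pinned G Bp Bm (fun M => s(u, v) ∈ M),
      lam ^ M.card = lam * lam ^ (M.erase s(u, v)).card := fun M hM =>
    pow_card_eq_mul_pow_card_erase _ (mem_pinned.1 hM).2.2
  rw [hT]
  refine Coupled.of_fiberwise (fun M => decide (v ∈ coveredVerts M)) fun p => ?_
  cases p
  · have hTp : (pinned (isolate G u) Bp Bm fun _ => True).filter
        (fun M => decide (v ∈ coveredVerts M) = false) =
        pinned (isolate G u) Bp Bm fun M => v ∉ coveredVerts M := by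
      ext M
      simp [mem_pinned, and_assoc]
    rw [hTp]
    have key := Coupled.refl (w := fun M : Finset (Sym2 V) => lam ^ M.card)
      (S := pinned (isolate G u) Bp Bm fun M => v ∉ coveredVerts M) (c := c)
      (d := fun M N => (vdistErase u (insert s(u, v) M) N : ℝ))
      (fun M _ => pow_nonneg hlam.le _) fun M _ =>
        le_trans (by exact_mod_cast vdistErase_insert_self_le M u v) hc1
    refine key.transport hbij (Set.bijOn_id _) hlam.le zero_le_one hw
      (fun M _ => (one_mul _).symm) fun M hM N hN => ?_
    rw [id, Finset.insert_erase (mem_pinned.1 hM).2.2]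
  · have hTp : (pinned (isolate G u) Bp Bm fun _ => True).filter
        (fun M => decide (v ∈ coveredVerts M) = true) =
        pinned (isolate G u) Bp Bm fun M => v ∈ coveredVerts M := by
      ext M
      simp [mem_pinned, and_assoc]
    rw [hTp]
    refine (coupled_uncovered_covered hlam hc (isolate G u) v Bp Bm (by omega) hdisj hv.1
      hv.2).transport hbij (Set.bijOn_id _) hlam.le zero_le_one hw
      (fun M _ => (one_mul _).symm) fun M hM N hN => ?_
    have hle := vdistErase_insert_le (v := u) (M := M.erase s(u, v)) (mem_pinned.1 hN).2.2
    rw [Finset.insert_erase (mem_pinned.1 hM).2.2] at hle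
    exact_mod_cast hle

/-- The edges on `W` that the embedding `e` maps into `M`. -/
noncomputable def pullback {W : Type*} [Fintype W] (e : W ↪ V) (M : Finset (Sym2 V)) :
    Finset (Sym2 W) :=
  Finset.univ.filter fun x => x.map e ∈ M

section Pullback

variable {W : Type*} [Fintype W] [DecidableEq W] {e : W ↪ V} {G : SimpleGraph V}
  {M N : Finset (Sym2 V)} {Bp Bm : Finset V}

omit [Fintype V] [DecidableEq W] in
theorem mem_pullback {x : Sym2 W} : x ∈ pullback e M ↔ x.map e ∈ M := by
  simp [pullback]

omit [Fintype V] [DecidableEq V] [Fintype W] [DecidableEq W] in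
theorem mem_edgeSet_comap {x : Sym2 W} : x ∈ (G.comap e).edgeSet ↔ x.map e ∈ G.edgeSet := by
  induction x with
  | _ a b => simp

omit [Fintype V] [DecidableEq V] [Fintype W] [DecidableEq W] in
theorem mem_map_embedding_iff {a : W} {x : Sym2 W} : e a ∈ x.map e ↔ a ∈ x := by
  simp [Sym2.mem_map]

omit [Fintype W] [DecidableEq W] in
theorem mem_range_of_mem (he : ∀ y ∈ G.edgeSet, y ∈ Set.range (Sym2.map e))
    (hM : IsMatchingSet G M) {x : V} (hx : x ∈ coveredVerts M) : x ∈ Set.range e := by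
  obtain ⟨y, hy, hxy⟩ := mem_coveredVerts.1 hx
  obtain ⟨z, rfl⟩ := he y (hM.1 y hy)
  obtain ⟨a, -, rfl⟩ := Sym2.mem_map.1 hxy
  exact ⟨a, rfl⟩

omit [Fintype V] [DecidableEq W] in
theorem image_pullback (he : ∀ y ∈ G.edgeSet, y ∈ Set.range (Sym2.map e))
    (hM : IsMatchingSet G M) : (pullback e M).image (Sym2.map e) = M := by
  ext y
  simp only [Finset.mem_image, mem_pullback]
  constructor
  · rintro ⟨x, hx, rfl⟩
    exact hx
  · intro hy
    obtain ⟨x, rfl⟩ := he y (hM.1 y hy)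
    exact ⟨x, hy, rfl⟩

omit [Fintype V] [DecidableEq W] in
theorem pullback_image (N : Finset (Sym2 W)) : pullback e (N.image (Sym2.map e)) = N := by
  ext x
  rw [mem_pullback, (Sym2.map.injective e.injective).mem_finset_image]

omit [Fintype V] [Fintype W] [DecidableEq W] in
theorem isMatchingSet_image {N : Finset (Sym2 W)} (hN : IsMatchingSet (G.comap e) N) :
    IsMatchingSet G (N.image (Sym2.map e)) := by
  refine ⟨?_, ?_⟩
  · intro y hy
    obtain ⟨x, hx, rfl⟩ := Finset.mem_image.1 hy
    exact mem_edgeSet_comap.1 (hN.1 x hx)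
  · intro y hy y' hy' hne v hv hv'
    obtain ⟨x, hx, rfl⟩ := Finset.mem_image.1 hy
    obtain ⟨x', hx', rfl⟩ := Finset.mem_image.1 hy'
    obtain ⟨a, ha, rfl⟩ := Sym2.mem_map.1 hv
    exact hN.2 x hx x' hx' (fun h => hne (h ▸ rfl)) a ha (mem_map_embedding_iff.1 hv')

omit [Fintype V] [DecidableEq W] in
theorem isMatchingSet_pullback (hM : IsMatchingSet G M) :
    IsMatchingSet (G.comap e) (pullback e M) := by
  refine ⟨fun x hx => mem_edgeSet_comap.2 (hM.1 _ (mem_pullback.1 hx)), ?_⟩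
  intro x hx y hy hne a hax hay
  exact hM.2 _ (mem_pullback.1 hx) _ (mem_pullback.1 hy)
    (fun h => hne (Sym2.map.injective e.injective h)) (e a) (mem_map_embedding_iff.2 hax)
    (mem_map_embedding_iff.2 hay)

theorem mem_coveredVerts_pullback (he : ∀ y ∈ G.edgeSet, y ∈ Set.range (Sym2.map e))
    (hM : IsMatchingSet G M) {a : W} :
    a ∈ coveredVerts (pullback e M) ↔ e a ∈ coveredVerts M := by
  simp only [mem_coveredVerts]
  constructor
  · rintro ⟨x, hx, hax⟩
    exact ⟨_, mem_pullback.1 hx, mem_map_embedding_iff.2 hax⟩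
  · rintro ⟨y, hy, hay⟩
    obtain ⟨x, rfl⟩ := he y (hM.1 y hy)
    exact ⟨x, mem_pullback.2 hy, mem_map_embedding_iff.1 hay⟩

theorem satisfiesPinning_pullback (he : ∀ y ∈ G.edgeSet, y ∈ Set.range (Sym2.map e))
    (hM : IsMatchingSet G M) (hBp : ∀ x ∈ Bp, x ∈ Set.range e) :
    satisfiesPinning (pullback e M) (Finset.univ.filter fun a => e a ∈ Bp)
      (Finset.univ.filter fun a => e a ∈ Bm) ↔ satisfiesPinning M Bp Bm := by
  simp only [satisfiesPinning, Finset.mem_filter, Finset.mem_univ, true_and,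
    mem_coveredVerts_pullback he hM]
  refine and_congr ⟨fun h x hx => ?_, fun h a ha => h _ ha⟩
    ⟨fun h x hx hcov => ?_, fun h a ha => h _ ha⟩
  · obtain ⟨a, rfl⟩ := hBp x hx
    exact h a hx
  · obtain ⟨a, rfl⟩ := mem_range_of_mem he hM hcov
    exact h a hx hcov

theorem bijOn_pullback (he : ∀ y ∈ G.edgeSet, y ∈ Set.range (Sym2.map e))
    (hBp : ∀ x ∈ Bp, x ∈ Set.range e) {q : Finset (Sym2 V) → Prop}
    {q' : Finset (Sym2 W) → Prop} (hq : ∀ M, q' (pullback e M) ↔ q M) :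
    Set.BijOn (pullback e) (pinned G Bp Bm q : Finset (Finset (Sym2 V)))
      (pinned (G.comap e) (Finset.univ.filter fun a => e a ∈ Bp)
        (Finset.univ.filter fun a => e a ∈ Bm) q' : Finset (Finset (Sym2 W))) := by
  refine ⟨?_, ?_, ?_⟩
  · intro M hM
    obtain ⟨h1, h2, h3⟩ := mem_pinned.1 hM
    exact mem_pinned.2 ⟨isMatchingSet_pullback h1, (satisfiesPinning_pullback he h1 hBp).2 h2,
      (hq M).2 h3⟩
  · intro M hM N hN hMN
    rw [← image_pullback he (mem_pinned.1 hM).1, ← image_pullback he (mem_pinned.1 hN).1, hMN]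
  · intro N hN
    obtain ⟨h1, h2, h3⟩ := mem_pinned.1 hN
    have hM := isMatchingSet_image h1
    rw [← pullback_image (e := e) N] at h2 h3
    exact ⟨N.image (Sym2.map e), mem_pinned.2 ⟨hM,
      (satisfiesPinning_pullback he hM hBp).1 h2, (hq _).1 h3⟩, pullback_image N⟩

theorem vdistErase_le_pullback (he : ∀ y ∈ G.edgeSet, y ∈ Set.range (Sym2.map e))
    (hM : IsMatchingSet G M) (hN : IsMatchingSet G N) (u : W) :
    vdistErase (e u) M N ≤ vdistErase u (pullback e M) (pullback e N) := by
  unfold vdistErase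
  rw [← Finset.card_map e]
  refine Finset.card_le_card fun x hx => ?_
  have hxr : x ∈ Set.range e := by
    simp only [Finset.mem_erase, Finset.mem_union, Finset.mem_sdiff] at hx
    rcases hx.2 with h | h
    · exact mem_range_of_mem he hM h.1
    · exact mem_range_of_mem he hN h.1
  obtain ⟨a, rfl⟩ := hxr
  rw [Finset.mem_map']
  simpa only [Finset.mem_erase, Finset.mem_union, Finset.mem_sdiff,
    mem_coveredVerts_pullback he hM, mem_coveredVerts_pullback he hN, ne_eq,
    e.injective.eq_iff] using hx

end Pullback

theorem card_coveredVerts_le (E : Finset (Sym2 V)) : (coveredVerts E).card ≤ 2 * E.card := by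
  have : coveredVerts E = E.biUnion Sym2.toFinset := by
    ext x
    simp [mem_coveredVerts]
  rw [this, mul_comm]
  refine Finset.card_biUnion_le_card_mul _ _ _ fun e _ => ?_
  rw [Sym2.card_toFinset]
  split_ifs <;> norm_num

theorem PendantBound.of_fin {lam : ℝ} {s : ℕ} {c : ℝ}
    (hc : PendantBound (Fin (2 * s)) lam s c) (hV : 2 * s ≤ Fintype.card V) :
    PendantBound V lam s c := by
  intro G u v Bp Bm hs hadj hdeg hdisj hu hv
  obtain ⟨T, hT, hcard⟩ := Finset.exists_superset_card_eq
    ((card_coveredVerts_le (edges G)).trans (Nat.mul_le_mul_left 2 hs)) hV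
  let e : Fin (2 * s) ↪ V :=
    (T.equivFinOfCardEq hcard).symm.toEmbedding.trans (Function.Embedding.subtype _)
  have hrange : ∀ x ∈ T, x ∈ Set.range e := fun x hx =>
    ⟨T.equivFinOfCardEq hcard ⟨x, hx⟩, by simp [e]⟩
  have hverts : ∀ a b, G.Adj a b → a ∈ Set.range e := fun a b hab =>
    hrange a (hT (mem_coveredVerts.2 ⟨s(a, b), mem_edges.2 hab, Sym2.mem_mk_left a b⟩))
  have he : ∀ y ∈ G.edgeSet, y ∈ Set.range (Sym2.map e) := by
    intro y hy
    induction y with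
    | _ a b =>
      obtain ⟨a', rfl⟩ := hverts a b hy
      obtain ⟨b', rfl⟩ := hverts b _ (show G.Adj (e a') b from hy).symm
      exact ⟨s(a', b'), rfl⟩
  by_cases hBp : ∀ x ∈ Bp, x ∈ Set.range e
  · obtain ⟨u, rfl⟩ := hverts u v hadj
    obtain ⟨v, rfl⟩ := hverts v _ hadj.symm
    have hedges : (edges (G.comap e)).card ≤ s := by
      refine le_trans (Finset.card_le_card_of_injOn (Sym2.map e) (fun x hx => ?_)
        (Sym2.map.injective e.injective).injOn) hs
      exact mem_edges.2 (mem_edgeSet_comap.1 (mem_edges.1 hx))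
    have hdeg' : degr (G.comap e) u = 1 := by
      refine Finset.card_eq_one.2 ⟨v, ?_⟩
      ext x
      simp only [Finset.mem_filter, Finset.mem_univ, true_and, Finset.mem_singleton,
        SimpleGraph.comap_adj]
      exact ⟨fun h => e.injective (eq_of_degr_eq_one hdeg hadj h), fun h => h ▸ hadj⟩
    refine (hc (G.comap e) u v (Finset.univ.filter fun a => e a ∈ Bp)
      (Finset.univ.filter fun a => e a ∈ Bm) hedges hadj hdeg' ?_ ?_ ?_).transport
      (bijOn_pullback he hBp fun _ => mem_pullback)
      (bijOn_pullback he hBp fun _ => not_congr mem_pullback) zero_le_one zero_le_one ?_ ?_ ?_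
    · rw [Finset.disjoint_left] at hdisj ⊢
      intro a ha hb
      exact hdisj (Finset.mem_filter.1 ha).2 (Finset.mem_filter.1 hb).2
    · simpa using hu
    · simpa using hv
    · intro M hM
      conv_lhs => rw [← image_pullback he (mem_pinned.1 hM).1]
      rw [Finset.card_image_of_injective _ (Sym2.map.injective e.injective), one_mul]
    · intro M hM
      conv_lhs => rw [← image_pullback he (mem_pinned.1 hM).1]
      rw [Finset.card_image_of_injective _ (Sym2.map.injective e.injective), one_mul]
    · intro M hM N hN
      exact_mod_cast vdistErase_le_pullback he (mem_pinned.1 hM).1 (mem_pinned.1 hN).1 u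
  · have hempty : (pinned G Bp Bm fun M => s(u, v) ∈ M) = ∅ := by
      refine Finset.eq_empty_of_forall_notMem fun M hM => hBp fun x hx => ?_
      obtain ⟨h1, h2, -⟩ := mem_pinned.1 hM
      exact mem_range_of_mem he h1 (h2.1 x hx)
    rw [hempty]
    exact Coupled.of_empty_left

theorem condDist_apply (G : SimpleGraph V) (lam : ℝ) (Bp Bm : Finset V)
    (q : Finset (Sym2 V) → Prop) (N : Finset (Sym2 V)) :
    condDist G lam (fun M => satisfiesPinning M Bp Bm ∧ q M) N =
      (if N ∈ pinned G Bp Bm q then lam ^ N.card else 0) /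
        ∑ M ∈ pinned G Bp Bm q, lam ^ M.card := by
  simp only [condDist, condDistMap, id]
  rw [Finset.sum_filter]
  simp only [Finset.sum_ite_eq']
  unfold pinned
  congr!

theorem PendantBound.of_kappaV_lt {lam : ℝ} (hlam : 0 < lam) {s : ℕ} {c : ℝ}
    (h : kappaV s lam < c) : PendantBound (Fin (2 * s)) lam s c := by
  intro G u v Bp Bm hs hadj hdeg hdisj hu hv
  have hpos : ∀ T : Finset (Finset (Sym2 (Fin (2 * s)))), T.Nonempty →
      0 < ∑ M ∈ T, lam ^ M.card := fun T hT => Finset.sum_pos (fun M _ => pow_pos hlam _) hT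
  rcases (pinned G Bp Bm fun M => s(u, v) ∈ M).eq_empty_or_nonempty with he | hS
  · rw [he]
    exact Coupled.of_empty_left
  rcases (pinned G Bp Bm fun M => s(u, v) ∉ M).eq_empty_or_nonempty with he | hT
  · rw [he]
    exact Coupled.of_empty_right
  refine Coupled.of_wass_lt (fun M => pow_nonneg hlam.le _) (hpos _ hS) (hpos _ hT)
    (condDist_apply G lam Bp Bm fun M => s(u, v) ∈ M)
    (condDist_apply G lam Bp Bm fun M => s(u, v) ∉ M) (lt_of_le_of_lt ?_ h)
  refine le_csSup ?_ ⟨G, u, v, Bp, Bm, hs, hadj, hdeg, hdisj, hu, hv, ?_, ?_, rfl⟩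
  · refine ((Set.finite_range fun x : SimpleGraph (Fin (2 * s)) × Fin (2 * s) × Fin (2 * s) ×
      Finset (Fin (2 * s)) × Finset (Fin (2 * s)) =>
      wass (fun M M' => (vdistErase x.2.1 M M' : ℝ))
        (condDist x.1 lam fun M =>
          satisfiesPinning M x.2.2.2.1 x.2.2.2.2 ∧ s(x.2.1, x.2.2.1) ∈ M)
        (condDist x.1 lam fun M =>
          satisfiesPinning M x.2.2.2.1 x.2.2.2.2 ∧ s(x.2.1, x.2.2.1) ∉ M)).subset ?_).bddAbove
    rintro _ ⟨G, u, v, Bp, Bm, -, -, -, -, -, -, -, -, rfl⟩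
    exact ⟨(G, u, v, Bp, Bm), rfl⟩
  · exact lt_of_lt_of_eq (hpos _ hS) (by unfold pinned; congr!)
  · exact lt_of_lt_of_eq (hpos _ hT) (by unfold pinned; congr!)

/-- the recursion `κ^V_{s+1,λ} ≤ max{κ^V_{s,λ}, 1}` for every `s ≥ 1`. -/
theorem stmt_12 (s : ℕ) (hs : 1 ≤ s) (lam : ℝ) (hlam : 0 < lam) :
    kappaV (s + 1) lam ≤ max (kappaV s lam) 1 := by
  refine Real.sSup_le ?_ (le_max_of_le_right zero_le_one)
  rintro _ ⟨G, u, v, Bp, Bm, hcard, hadj, hdeg, hdisj, hu, hv, hS, hT, rfl⟩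
  refine le_of_forall_gt_imp_ge_of_dense fun c hc => ?_
  obtain ⟨hc, hc1⟩ := max_lt_iff.1 hc
  have key := ((PendantBound.of_kappaV_lt hlam hc).of_fin (V := Fin (2 * (s + 1)))
    (by simp)).succ hlam hc1.le G u v Bp Bm hcard hadj hdeg hdisj hu hv
  refine key.wass_le ?_ ?_ (fun _ _ => Nat.cast_nonneg _)
    (condDist_apply G lam Bp Bm fun M => s(u, v) ∈ M)
    (condDist_apply G lam Bp Bm fun M => s(u, v) ∉ M)
  · unfold pinned
    convert hS
  · unfold pinned
    convert hT

end SensMatching
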